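/- arXiv:0810.4433 — 2 statements merged into one kernel-verified Lean document; each statement's English description precedes it below -/
import Mathlib

section
/- Let α ∈ ℂ with α ≠ 0 and α ≠ 1, let U ⊆ ℂ be a nonempty open connected set, and let f : ℂ → ℂ be continuous on U, injective on U, and satisfy the cross-ratio condition φ(α) on U. Then f is the restriction to U of a Möbius transformation: there exist a, b, c, d ∈ ℂ with a·d − b·c ≠ 0 such that either (for all z ∈ U, c·z + d ≠ 0 and f z = (a·z + b)/(c·z + d)) or (for all z ∈ U, c·(conj z) + d ≠ 0 and f z = (a·(conj z) + b)/(c·(conj z) + d)). -/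
/-- `f` satisfies the cross-ratio condition φ(α) on `U`: every quadruple of
pairwise distinct points of `U` with cross ratio `α` is mapped to a quadruple
with cross ratio `α` (finite-valued planar form). -/
def CrossRatioCond (α : ℂ) (U : Set ℂ) (f : ℂ → ℂ) : Prop :=
  ∀ z₁ ∈ U, ∀ z₂ ∈ U, ∀ z₃ ∈ U, ∀ z₄ ∈ U,
    z₁ ≠ z₂ → z₁ ≠ z₃ → z₁ ≠ z₄ → z₂ ≠ z₃ → z₂ ≠ z₄ → z₃ ≠ z₄ →
    (z₁ - z₃) * (z₂ - z₄) = α * ((z₃ - z₂) * (z₄ - z₁)) →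
    (f z₁ - f z₃) * (f z₂ - f z₄) = α * ((f z₃ - f z₂) * (f z₄ - f z₁))

open Filter Topology ComplexConjugate

section LocallyAdditive

variable {E F : Type*} [NormedAddCommGroup E] [NormedSpace ℝ E]
  [NormedAddCommGroup F] [NormedSpace ℝ F]

theorem map_natCast_smul_of_locally_additive {G : E → F} {δ : ℝ} (hδ : 0 < δ)
    (hadd : ∀ u v, ‖u‖ < δ → ‖v‖ < δ → G (u + v) = G u + G v)
    (w : E) (k : ℕ) (hk : ‖(k : ℝ) • w‖ < δ) : G ((k : ℝ) • w) = (k : ℝ) • G w := by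
  induction k with
  | zero =>
    have h := hadd 0 0 (by simpa) (by simpa)
    simpa using h
  | succ k ih =>
    rw [norm_smul, Real.norm_natCast] at hk ih
    push_cast at hk ⊢
    have hw : 0 ≤ ‖w‖ := norm_nonneg w
    have hkw : 0 ≤ (k : ℝ) * ‖w‖ := by positivity
    have h1 : (k : ℝ) * ‖w‖ < δ := by nlinarith
    rw [add_smul, one_smul, hadd _ _ (by rwa [norm_smul, Real.norm_natCast]) (by nlinarith), ih h1,
      add_smul, one_smul]

/-- A locally additive map that is continuous at the origin coincides near the origin with a
continuous real-linear map. -/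
theorem exists_continuousLinearMap_of_locally_additive {G : E → F} {δ : ℝ} (hδ : 0 < δ)
    (hadd : ∀ u v, ‖u‖ < δ → ‖v‖ < δ → G (u + v) = G u + G v) (hc : ContinuousAt G 0) :
    ∃ L : E →L[ℝ] F, ∀ z, ‖z‖ < δ → G z = L z := by
  have key : ∀ (z : E) (n m : ℕ), 0 < n → 0 < m → ‖z‖ < n * δ → ‖z‖ < m * δ →
      (n : ℝ) • G ((n : ℝ)⁻¹ • z) = (m : ℝ) • G ((m : ℝ)⁻¹ • z) := by
    have aux : ∀ (z : E) (n m : ℕ), 0 < n → 0 < m → ‖z‖ < n * δ →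
        (n : ℝ) • G ((n : ℝ)⁻¹ • z) = ((n : ℝ) * m) • G (((n : ℝ) * m)⁻¹ • z) := by
      intro z n m hn hm hz
      have hn' : (0 : ℝ) < n := by exact_mod_cast hn
      have hm' : (0 : ℝ) < m := by exact_mod_cast hm
      have e : (m : ℝ) • (((n : ℝ) * m)⁻¹ • z) = (n : ℝ)⁻¹ • z := by
        rw [smul_smul]; congr 1; field_simp
      have h := map_natCast_smul_of_locally_additive hδ hadd (((n : ℝ) * m)⁻¹ • z) m (by
        rw [e, norm_smul, norm_inv, Real.norm_natCast, inv_mul_lt_iff₀ hn']; exact hz)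
      rw [← e, h, smul_smul]
    intro z n m hn hm hzn hzm
    rw [aux z n m hn hm hzn, aux z m n hm hn hzm, mul_comm]
  let N : E → ℕ := fun z => ⌊‖z‖ / δ⌋₊ + 1
  have hN : ∀ z, ‖z‖ < N z * δ := fun z => by
    rw [← div_lt_iff₀ hδ]
    simpa [N] using Nat.lt_floor_add_one (‖z‖ / δ)
  have hNpos : ∀ z, 0 < N z := fun z => Nat.succ_pos _
  let L₀ : E → F := fun z => (N z : ℝ) • G ((N z : ℝ)⁻¹ • z)
  have hL₀ : ∀ z (n : ℕ), 0 < n → ‖z‖ < n * δ → L₀ z = (n : ℝ) • G ((n : ℝ)⁻¹ • z) :=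
    fun z n hn hz => key z (N z) n (hNpos z) hn (hN z) hz
  have hL₀G : ∀ z, ‖z‖ < δ → L₀ z = G z := fun z hz => by
    simpa using hL₀ z 1 one_pos (by simpa using hz)
  have hLadd : ∀ u v, L₀ (u + v) = L₀ u + L₀ v := by
    intro u v
    set n := N u + N v with hn
    have hu := hN u
    have hv := hN v
    have hnpos : 0 < n := Nat.add_pos_left (hNpos u) _
    have hnn : (n : ℝ) = N u + N v := by rw [hn]; push_cast; rfl
    have hn' : (0 : ℝ) < n := by exact_mod_cast hnpos
    have hun : ‖u‖ < n * δ := by rw [hnn]; nlinarith [Nat.cast_nonneg (α := ℝ) (N v)]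
    have hvn : ‖v‖ < n * δ := by rw [hnn]; nlinarith [Nat.cast_nonneg (α := ℝ) (N u)]
    have huvn : ‖u + v‖ < n * δ := by
      rw [hnn]; nlinarith [norm_add_le u v]
    have small : ∀ x : E, ‖x‖ < n * δ → ‖(n : ℝ)⁻¹ • x‖ < δ := fun x hx => by
      rwa [norm_smul, norm_inv, Real.norm_natCast, inv_mul_lt_iff₀ hn']
    rw [hL₀ _ n hnpos huvn, hL₀ _ n hnpos hun, hL₀ _ n hnpos hvn, smul_add,
      hadd _ _ (small u hun) (small v hvn), smul_add]
  let A : E →+ F := AddMonoidHom.mk' L₀ hLadd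
  have hev : L₀ =ᶠ[𝓝 0] G := by
    filter_upwards [Metric.ball_mem_nhds (0 : E) hδ] with z hz
    exact hL₀G z (by simpa using hz)
  have hA : Continuous A := continuous_of_continuousAt_zero A (hc.congr hev.symm)
  exact ⟨A.toRealLinearMap hA, fun z hz => (hL₀G z hz).symm⟩

end LocallyAdditive

theorem exists_eq_mul_add_mul_conj (L : ℂ →L[ℝ] ℂ) :
    ∃ a b : ℂ, ∀ z, L z = a * z + b * conj z := by
  refine ⟨(L 1 - Complex.I * L Complex.I) / 2, (L 1 + Complex.I * L Complex.I) / 2, fun z => ?_⟩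
  have h : L z = z.re * L 1 + z.im * L Complex.I := by
    conv_lhs => rw [show z = z.re • (1 : ℂ) + z.im • Complex.I by simp [Complex.re_add_im]]
    rw [map_add, map_smul, map_smul, Complex.real_smul, Complex.real_smul]
  have hz : conj z = z.re - z.im * Complex.I := by
    apply Complex.ext <;> simp
  have hz' : z = z.re + z.im * Complex.I := (Complex.re_add_im z).symm
  rw [h]
  linear_combination (z.im * L Complex.I) * Complex.I_sq
    - (L 1 - Complex.I * L Complex.I) / 2 * hz' - (L 1 + Complex.I * L Complex.I) / 2 * hz

/-- A continuous solution of `G ((1 - α) x + α y) = (1 - α) G x + α G y` near the origin with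
`G 0 = 0` is real-linear near the origin. -/
theorem exists_eq_of_affine_equation {α : ℂ} (hα0 : α ≠ 0) (hα1 : α ≠ 1) {G : ℂ → ℂ} {r : ℝ}
    (hr : 0 < r) (hc : ContinuousAt G 0) (h0 : G 0 = 0)
    (hG : ∀ x y, ‖x‖ < r → ‖y‖ < r → ‖(1 - α) * x + α * y‖ < r →
      G ((1 - α) * x + α * y) = (1 - α) * G x + α * G y) :
    ∃ δ > 0, ∃ a b : ℂ, b * (conj α - α) = 0 ∧ ∀ z, ‖z‖ < δ → G z = a * z + b * conj z := by
  have hβ : 1 - α ≠ 0 := sub_ne_zero.2 (Ne.symm hα1)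
  have hα' : 0 < ‖α‖ := norm_pos_iff.2 hα0
  have hβ' : 0 < ‖1 - α‖ := norm_pos_iff.2 hβ
  have hmα : ∀ y, ‖y‖ < r → ‖α * y‖ < r → G (α * y) = α * G y := fun y h1 h2 => by
    simpa [h0] using hG 0 y (by simpa) h1 (by simpa using h2)
  have hmβ : ∀ x, ‖x‖ < r → ‖(1 - α) * x‖ < r → G ((1 - α) * x) = (1 - α) * G x :=
    fun x h1 h2 => by simpa [h0] using hG x 0 h1 (by simpa) (by simpa using h2)
  obtain ⟨δ, hδ, hδ1, hδ2, hδ3⟩ : ∃ δ > 0, δ ≤ r / 2 ∧ δ ≤ r * ‖α‖ ∧ δ ≤ r * ‖1 - α‖ :=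
    ⟨min (r / 2) (min (r * ‖α‖) (r * ‖1 - α‖)), by positivity, min_le_left _ _,
      (min_le_right _ _).trans (min_le_left _ _), (min_le_right _ _).trans (min_le_right _ _)⟩
  have hadd : ∀ u v, ‖u‖ < δ → ‖v‖ < δ → G (u + v) = G u + G v := by
    intro u v hu hv
    have eu : (1 - α) * (u / (1 - α)) = u := by field_simp
    have ev : α * (v / α) = v := by field_simp
    have hu' : ‖u / (1 - α)‖ < r := by rw [norm_div, div_lt_iff₀ hβ']; linarith
    have hv' : ‖v / α‖ < r := by rw [norm_div, div_lt_iff₀ hα']; linarith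
    have h := hG (u / (1 - α)) (v / α) hu' hv'
    rw [← hmα _ hv' (by rw [ev]; linarith), ← hmβ _ hu' (by rw [eu]; linarith), eu, ev] at h
    exact h (by linarith [norm_add_le u v])
  obtain ⟨L, hL⟩ := exists_continuousLinearMap_of_locally_additive hδ hadd hc
  obtain ⟨a, b, hab⟩ := exists_eq_mul_add_mul_conj L
  refine ⟨δ, hδ, a, b, ?_, fun z hz => by rw [hL z hz, hab]⟩
  obtain ⟨t, ht, ht1, ht2⟩ : ∃ t : ℝ, 0 < t ∧ t < δ ∧ ‖α‖ * t < δ := by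
    refine ⟨δ / (2 * (1 + ‖α‖)), by positivity, ?_, ?_⟩
    · rw [div_lt_iff₀ (by positivity)]; nlinarith
    · rw [← mul_div_assoc, div_lt_iff₀ (by positivity)]; nlinarith
  have nt : ‖(t : ℂ)‖ = t := by simp [abs_of_pos ht]
  have h := hmα t (by rw [nt]; linarith) (by rw [norm_mul, nt]; linarith)
  rw [hL _ (by rw [norm_mul, nt]; exact ht2), hL _ (by rw [nt]; exact ht1), hab, hab] at h
  simp only [map_mul, Complex.conj_ofReal] at h
  have ht' : (t : ℂ) ≠ 0 := by exact_mod_cast ht.ne'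
  apply mul_right_cancel₀ ht'
  linear_combination h

/-- A real-linear map preserving a real cross ratio near the origin is complex linear or
conjugate linear. -/
theorem mul_eq_zero_of_crossRatioCond {α : ℝ} (hα0 : α ≠ 0) (hα1 : α ≠ 1) {a b : ℂ} {δ : ℝ}
    (hδ : 0 < δ)
    (h : CrossRatioCond α (Metric.ball 0 δ) fun z => a * z + b * conj z) : a * b = 0 := by
  obtain ⟨t, ht, htδ⟩ : ∃ t : ℝ, 0 < t ∧ t < δ := exists_between hδ
  have htc : (t : ℂ) ≠ 0 := by exact_mod_cast ht.ne'
  have hne : ∀ x : ℝ, (x : ℂ) + Complex.I ≠ 0 := fun x hx => by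
    simpa using congrArg Complex.im hx
  have hne' : ∀ x : ℝ, (x : ℂ) - Complex.I ≠ 0 := fun x hx => by
    simpa using congrArg Complex.im hx
  have hmem : ∀ x : ℝ, (t : ℂ) / (x + Complex.I) ∈ Metric.ball (0 : ℂ) δ := fun x => by
    rw [mem_ball_zero_iff, norm_div, Complex.norm_real, Real.norm_of_nonneg ht.le]
    have h1 : 1 ≤ ‖(x : ℂ) + Complex.I‖ := by
      have := Complex.abs_im_le_norm ((x : ℂ) + Complex.I)
      simpa using this
    exact (div_le_self ht.le h1).trans_lt htδ
  have hinj : ∀ x y : ℝ, x ≠ y → (t : ℂ) / (x + Complex.I) ≠ t / (y + Complex.I) := by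
    intro x y hxy hh
    rw [div_eq_div_iff (hne x) (hne y)] at hh
    have := mul_left_cancel₀ htc hh
    exact hxy (by simpa using (congrArg Complex.re this).symm)
  have h0 : ∀ x : ℝ, (0 : ℂ) ≠ t / (x + Complex.I) := fun x =>
    (div_ne_zero htc (hne x)).symm
  have n0 := hne 0
  have n1 := hne 1
  have nα := hne α
  have m0 := hne' 0
  have m1 := hne' 1
  have mα := hne' α
  have key := h 0 (by simpa) _ (hmem 0) _ (hmem 1) _ (hmem α) (h0 0) (h0 1) (h0 α)
    (hinj 0 1 zero_ne_one) (hinj 0 α hα0.symm) (hinj 1 α hα1.symm) (by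
      push_cast at *
      field_simp
      ring)
  have hconj : ∀ x : ℝ, conj ((t : ℂ) / (x + Complex.I)) = t / (x - Complex.I) := fun x => by
    simp [sub_eq_add_neg]
  simp only [hconj, map_zero] at key
  have hI := Complex.I_sq
  have hs0 : (α : ℂ) ^ 2 + 1 ≠ 0 := by
    have : α ^ 2 + 1 ≠ 0 := by positivity
    exact_mod_cast this
  have hs : ((α : ℂ) ^ 2 + 1) * ((α : ℂ) ^ 2 + 1)⁻¹ = 1 := mul_inv_cancel₀ hs0
  set s := ((α : ℂ) ^ 2 + 1)⁻¹
  have e4 : (t : ℂ) / (α + Complex.I) = t * s * (α - Complex.I) := by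
    rw [div_eq_iff nα]; linear_combination (-t : ℂ) * hs + t * s * hI
  have e4' : (t : ℂ) / (α - Complex.I) = t * s * (α + Complex.I) := by
    rw [div_eq_iff mα]; linear_combination (-t : ℂ) * hs + t * s * hI
  have e3 : (t : ℂ) / ((1 : ℝ) + Complex.I) = t / 2 * (1 - Complex.I) := by
    rw [div_eq_iff n1]; push_cast; linear_combination (t / 2 : ℂ) * hI
  have e3' : (t : ℂ) / ((1 : ℝ) - Complex.I) = t / 2 * (1 + Complex.I) := by
    rw [div_eq_iff m1]; push_cast; linear_combination (t / 2 : ℂ) * hI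
  have e2 : (t : ℂ) / ((0 : ℝ) + Complex.I) = -t * Complex.I := by
    rw [div_eq_iff n0]; push_cast; linear_combination (t : ℂ) * hI
  have e2' : (t : ℂ) / ((0 : ℝ) - Complex.I) = t * Complex.I := by
    rw [div_eq_iff m0]; push_cast; linear_combination (t : ℂ) * hI
  simp only [e2, e2', e3, e3', e4, e4'] at key
  have hab : a * b * (2 * α * (1 - α) * t ^ 2 * s) = 0 := by
    clear_value s
    grind
  refine (mul_eq_zero.1 hab).resolve_right ?_
  have hαc : (α : ℂ) ≠ 0 := by exact_mod_cast hα0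
  have hα1c : 1 - (α : ℂ) ≠ 0 := sub_ne_zero.2 (by exact_mod_cast hα1.symm)
  have hs' : s ≠ 0 := inv_ne_zero hs0
  simp [*]

theorem crossRatio_inv_iff {α u₁ u₂ u₃ u₄ : ℂ} (h₁ : u₁ ≠ 0) (h₂ : u₂ ≠ 0) (h₃ : u₃ ≠ 0)
    (h₄ : u₄ ≠ 0) :
    (u₁⁻¹ - u₃⁻¹) * (u₂⁻¹ - u₄⁻¹) = α * ((u₃⁻¹ - u₂⁻¹) * (u₄⁻¹ - u₁⁻¹)) ↔
      (u₁ - u₃) * (u₂ - u₄) = α * ((u₃ - u₂) * (u₄ - u₁)) := by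
  rw [← sub_eq_zero, ← sub_eq_zero (a := (u₁ - u₃) * (u₂ - u₄))]
  have : (u₁⁻¹ - u₃⁻¹) * (u₂⁻¹ - u₄⁻¹) - α * ((u₃⁻¹ - u₂⁻¹) * (u₄⁻¹ - u₁⁻¹)) =
      ((u₁ - u₃) * (u₂ - u₄) - α * ((u₃ - u₂) * (u₄ - u₁))) / (u₁ * u₂ * u₃ * u₄) := by
    field_simp
    ring
  rw [this, div_eq_zero_iff, or_iff_left (by simp [*])]

theorem crossRatio_inv_zero_iff {α u₂ u₃ u₄ : ℂ} (h₂ : u₂ ≠ 0) (h₃ : u₃ ≠ 0) (h₄ : u₄ ≠ 0) :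
    -u₃⁻¹ * (u₂⁻¹ - u₄⁻¹) = α * ((u₃⁻¹ - u₂⁻¹) * u₄⁻¹) ↔ u₄ = (1 - α) * u₂ + α * u₃ := by
  rw [← sub_eq_zero, ← sub_eq_zero (a := u₄)]
  have : -u₃⁻¹ * (u₂⁻¹ - u₄⁻¹) - α * ((u₃⁻¹ - u₂⁻¹) * u₄⁻¹) =
      -(u₄ - ((1 - α) * u₂ + α * u₃)) / (u₂ * u₃ * u₄) := by
    field_simp
    ring
  rw [this, div_eq_zero_iff, or_iff_left (by simp [*]), neg_eq_zero]

section Inversion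

variable {α : ℂ} {U : Set ℂ} {f : ℂ → ℂ} {p : ℂ}

theorem CrossRatioCond.inversion (hinj : Set.InjOn f U) (hφ : CrossRatioCond α U f) (hp : p ∈ U) :
    CrossRatioCond α {w | w ≠ 0 ∧ p + w⁻¹ ∈ U} fun w => (f (p + w⁻¹) - f p)⁻¹ := by
  rintro w₁ ⟨n₁, m₁⟩ w₂ ⟨n₂, m₂⟩ w₃ ⟨n₃, m₃⟩ w₄ ⟨n₄, m₄⟩ h₁₂ h₁₃ h₁₄ h₂₃ h₂₄ h₃₄ h
  have hg : ∀ w, w ≠ 0 → p + w⁻¹ ∈ U → f (p + w⁻¹) - f p ≠ 0 := fun w hw hm h0 =>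
    hw (by simpa using hinj hm hp (sub_eq_zero.1 h0))
  have hne : ∀ {w w' : ℂ}, w ≠ w' → p + w⁻¹ ≠ p + w'⁻¹ := fun h => by simpa using h
  rw [crossRatio_inv_iff (hg _ n₁ m₁) (hg _ n₂ m₂) (hg _ n₃ m₃) (hg _ n₄ m₄)]
  simpa using hφ _ m₁ _ m₂ _ m₃ _ m₄ (hne h₁₂) (hne h₁₃) (hne h₁₄) (hne h₂₃) (hne h₂₄) (hne h₃₄)
    (by simpa using (crossRatio_inv_iff n₁ n₂ n₃ n₄).2 h)

theorem CrossRatioCond.inversion_affine (hα0 : α ≠ 0) (hα1 : α ≠ 1) (hinj : Set.InjOn f U)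
    (hφ : CrossRatioCond α U f) (hp : p ∈ U) {x y w : ℂ} (hx : x ≠ 0) (hxU : p + x⁻¹ ∈ U)
    (hy : y ≠ 0) (hyU : p + y⁻¹ ∈ U) (hw : w ≠ 0) (hwU : p + w⁻¹ ∈ U)
    (h : w = (1 - α) * x + α * y) :
    (f (p + w⁻¹) - f p)⁻¹ = (1 - α) * (f (p + x⁻¹) - f p)⁻¹ + α * (f (p + y⁻¹) - f p)⁻¹ := by
  have hβ : 1 - α ≠ 0 := sub_ne_zero.2 (Ne.symm hα1)
  rcases eq_or_ne x y with rfl | hxy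
  · obtain rfl : w = x := by rw [h]; ring
    ring
  have hg : ∀ w, w ≠ 0 → p + w⁻¹ ∈ U → f (p + w⁻¹) - f p ≠ 0 := fun w hw hm h0 =>
    hw (by simpa using hinj hm hp (sub_eq_zero.1 h0))
  have hne : ∀ {w w' : ℂ}, w ≠ w' → p + w⁻¹ ≠ p + w'⁻¹ := fun h => by simpa using h
  have hne0 : ∀ {w : ℂ}, w ≠ 0 → p ≠ p + w⁻¹ := fun h => by simpa using h
  have hxw : x ≠ w := fun e => hxy <| mul_left_cancel₀ hα0 (by linear_combination e + h)
  have hyw : y ≠ w := fun e => hxy <| mul_left_cancel₀ hβ (by linear_combination -e - h)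
  rw [← crossRatio_inv_zero_iff (inv_ne_zero (hg _ hx hxU)) (inv_ne_zero (hg _ hy hyU))
    (inv_ne_zero (hg _ hw hwU))]
  simpa using hφ p hp _ hxU _ hyU _ hwU (hne0 hx) (hne0 hy) (hne0 hw) (hne hxy) (hne hxw) (hne hyw)
    (by simpa using (crossRatio_inv_zero_iff hx hy hw).2 h)

end Inversion

/-- `g` coincides with a Möbius transformation near `q`. -/
def MoebiusAt (g : ℂ → ℂ) (q : ℂ) : Prop :=
  ∃ a b c d : ℂ, a * d - b * c ≠ 0 ∧ ∀ᶠ z in 𝓝 q, c * z + d ≠ 0 ∧ g z = (a * z + b) / (c * z + d)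

theorem isOpen_setOf_moebiusAt (g : ℂ → ℂ) : IsOpen {q | MoebiusAt g q} := by
  rw [isOpen_iff_eventually]
  rintro q ⟨a, b, c, d, hdet, h⟩
  filter_upwards [eventually_eventually_nhds.2 h] with z hz using ⟨a, b, c, d, hdet, hz⟩

theorem MoebiusAt.analyticAt {g : ℂ → ℂ} {q : ℂ} (h : MoebiusAt g q) : AnalyticAt ℂ g q := by
  obtain ⟨a, b, c, d, -, h⟩ := h
  have : AnalyticAt ℂ (fun z => (a * z + b) / (c * z + d)) q :=
    AnalyticAt.div (by fun_prop) (by fun_prop) h.self_of_nhds.1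
  exact this.congr (h.mono fun z hz => hz.2.symm)

theorem MoebiusAt.exists_hasDerivAt {g : ℂ → ℂ} {q : ℂ} (h : MoebiusAt g q) :
    ∃ m ≠ 0, HasDerivAt g m q := by
  obtain ⟨a, b, c, d, hdet, h⟩ := h
  have h0 := h.self_of_nhds.1
  have h1 : HasDerivAt (fun z => a * z + b) a q := by
    simpa using ((hasDerivAt_id q).const_mul a).add_const b
  have h2 : HasDerivAt (fun z => c * z + d) c q := by
    simpa using ((hasDerivAt_id q).const_mul c).add_const d
  refine ⟨_, ?_, (h1.div h2 h0).congr_of_eventuallyEq (h.mono fun z hz => hz.2)⟩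
  refine div_ne_zero ?_ (pow_ne_zero 2 h0)
  convert hdet using 1
  ring

theorem MoebiusAt.not_conj {g : ℂ → ℂ} {q : ℂ} (h : MoebiusAt g q) :
    ¬ MoebiusAt (fun z => conj (g z)) q := by
  intro h'
  obtain ⟨m, hm, hd⟩ := h.exists_hasDerivAt
  obtain ⟨m', -, hd'⟩ := h'.exists_hasDerivAt
  have e := (hd'.hasFDerivAt.restrictScalars ℝ).unique
    ((Complex.conjCLE.hasFDerivAt (x := g q)).comp q (hd.hasFDerivAt.restrictScalars ℝ))
  have e1 := congrArg (fun T => T 1) e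
  have e2 := congrArg (fun T => T Complex.I) e
  simp at e1 e2
  rw [e1] at e2
  have : Complex.I * conj m = 0 := by linear_combination e2 / 2
  simp [hm] at this

/-- A function that is locally Möbius on a connected open set is globally Möbius there. -/
theorem exists_moebius_of_forall_moebiusAt {g : ℂ → ℂ} {U : Set ℂ} (hU : IsConnected U)
    (h : ∀ q ∈ U, MoebiusAt g q) :
    ∃ a b c d : ℂ, a * d - b * c ≠ 0 ∧ ∀ z ∈ U, c * z + d ≠ 0 ∧ g z = (a * z + b) / (c * z + d) := by
  obtain ⟨q, hq⟩ := hU.nonempty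
  obtain ⟨a, b, c, d, hdet, hev⟩ := h q hq
  have hg : AnalyticOnNhd ℂ g U := fun z hz => (h z hz).analyticAt
  have hl : AnalyticOnNhd ℂ (fun z => (c * z + d) * g z) U := fun z hz =>
    AnalyticAt.mul (by fun_prop) (hg z hz)
  have hr : AnalyticOnNhd ℂ (fun z => a * z + b) U := fun z _ => by fun_prop
  have heq := hl.eqOn_of_preconnected_of_eventuallyEq hr hU.isPreconnected hq
    (hev.mono fun z hz => by
      have := hz.1
      simp only [hz.2]
      field_simp)
  refine ⟨a, b, c, d, hdet, fun z hz => ?_⟩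
  have e : (c * z + d) * g z = a * z + b := heq hz
  have hne : c * z + d ≠ 0 := fun h0 => hdet <| by
    rw [h0, zero_mul] at e
    have e1 : (a * d - b * c) * z = 0 := by linear_combination -b * h0 - d * e
    rcases mul_eq_zero.1 e1 with h1 | rfl
    · exact h1
    · linear_combination a * h0 + c * e
  exact ⟨hne, by rw [eq_div_iff hne, mul_comm, e]⟩

theorem moebiusAt_of_inv_sub_eventuallyEq {g : ℂ → ℂ} {p q A B : ℂ} (hA : A ≠ 0)
    (h : ∀ᶠ z in 𝓝 q, z ≠ p ∧ g z ≠ g p ∧ (g z - g p)⁻¹ = A * (z - p)⁻¹ + B) :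
    MoebiusAt g q := by
  refine ⟨g p * B + 1, g p * (A - B * p) - p, B, A - B * p, ?_, h.mono ?_⟩
  · convert hA using 1
    ring
  · rintro z ⟨hz, hg, e⟩
    have hz' := sub_ne_zero.2 hz
    have hg' := sub_ne_zero.2 hg
    have e' : (g z - g p) * (B * z + (A - B * p)) = z - p := by
      field_simp at e
      linear_combination -e
    have hne : B * z + (A - B * p) ≠ 0 := fun h0 => hz' (by rw [← e', h0, mul_zero])
    refine ⟨hne, ?_⟩
    rw [eq_div_iff hne]
    linear_combination e'

theorem CrossRatioCond.moebiusAt_or {α : ℂ} (hα0 : α ≠ 0) (hα1 : α ≠ 1) {U : Set ℂ}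
    (hU : IsOpen U) {f : ℂ → ℂ} (hf : ContinuousOn f U) (hinj : Set.InjOn f U)
    (hφ : CrossRatioCond α U f) {q : ℂ} (hq : q ∈ U) :
    MoebiusAt f q ∨ MoebiusAt (fun z => conj (f z)) q := by
  obtain ⟨ε, hε, hball⟩ := Metric.isOpen_iff.1 hU q hq
  obtain ⟨t, ht, htε⟩ : ∃ t : ℝ, 0 < t ∧ 3 * t < ε := ⟨ε / 4, by positivity, by linarith⟩
  have htc : (t : ℂ) ≠ 0 := by exact_mod_cast ht.ne'
  have nt : ‖(t : ℂ)‖ = t := by simp [abs_of_pos ht]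
  set p := q - t with hp_def
  have hp : p ∈ U := hball (by rw [mem_ball_iff_norm, hp_def]; simp [abs_of_pos ht]; linarith)
  set c : ℂ := (t : ℂ)⁻¹ with hc_def
  have hpc : p + c⁻¹ = q := by simp [hp_def, hc_def]
  set r : ℝ := (2 * t)⁻¹ with hr_def
  have hr : 0 < r := by positivity
  have hnc : ‖c‖ = 2 * r := by
    rw [hc_def, norm_inv, nt, hr_def]; field_simp
  have hlow : ∀ x : ℂ, ‖x‖ < r → r < ‖c + x‖ := fun x hx => by
    have := norm_sub_le (c + x) x
    rw [add_sub_cancel_right, hnc] at this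
    linarith
  have hV0 : ∀ x : ℂ, ‖x‖ < r → c + x ≠ 0 := fun x hx =>
    norm_pos_iff.1 (hr.trans (hlow x hx))
  have hVU : ∀ x : ℂ, ‖x‖ < r → p + (c + x)⁻¹ ∈ U := fun x hx => by
    apply hball
    rw [mem_ball_iff_norm, show p + (c + x)⁻¹ - q = (c + x)⁻¹ - t by rw [hp_def]; ring]
    have h1 : ‖(c + x)⁻¹‖ < 2 * t := by
      rw [norm_inv]
      refine (inv_strictAnti₀ hr (hlow x hx)).trans_eq ?_
      rw [hr_def, inv_inv]
    have := norm_sub_le (c + x)⁻¹ (t : ℂ)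
    rw [nt] at this
    linarith
  set F : ℂ → ℂ := fun w => (f (p + w⁻¹) - f p)⁻¹ with hF
  have hg : ∀ x : ℂ, ‖x‖ < r → f (p + (c + x)⁻¹) - f p ≠ 0 := fun x hx h0 =>
    hV0 x hx (by simpa using hinj (hVU x hx) hp (sub_eq_zero.1 h0))
  have hcont : ContinuousAt (fun x => F (c + x) - F c) 0 := by
    have h1 : ContinuousAt (fun x : ℂ => p + (c + x)⁻¹) 0 :=
      continuousAt_const.add
        ((continuousAt_const.add continuousAt_id).inv₀ (hV0 0 (by simpa)))
    have h2 : ContinuousAt f (p + (c + 0)⁻¹) :=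
      hf.continuousAt (hU.mem_nhds (hVU 0 (by simpa)))
    exact (((h2.comp (f := fun x : ℂ => p + (c + x)⁻¹) h1).sub continuousAt_const).inv₀
      (hg 0 (by simpa))).sub continuousAt_const
  obtain ⟨δ₀, hδ₀, a, b, hbα, hlin₀⟩ := exists_eq_of_affine_equation hα0 hα1 hr hcont (by simp)
    (fun x y hx hy hxy => by
      have := hφ.inversion_affine hα0 hα1 hinj hp (hV0 x hx) (hVU x hx) (hV0 y hy) (hVU y hy)
        (hV0 _ hxy) (hVU _ hxy) (by ring)
      simp only [hF]
      rw [this]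
      ring)
  obtain ⟨δ, hδ, hδr, hlin⟩ : ∃ δ > 0, δ ≤ r ∧
      ∀ x, ‖x‖ < δ → F (c + x) - F c = a * x + b * conj x :=
    ⟨min δ₀ r, by positivity, min_le_right _ _, fun x hx => hlin₀ x (hx.trans_le (min_le_left _ _))⟩
  have hab : a * b = 0 := by
    rcases mul_eq_zero.1 hbα with hb | hα
    · rw [hb, mul_zero]
    obtain ⟨s, rfl⟩ := Complex.conj_eq_iff_real.1 (sub_eq_zero.1 hα)
    refine mul_eq_zero_of_crossRatioCond (α := s) (by exact_mod_cast hα0) (by exact_mod_cast hα1)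
      hδ ?_
    intro z₁ h₁ z₂ h₂ z₃ h₃ z₄ h₄ h₁₂ h₁₃ h₁₄ h₂₃ h₂₄ h₃₄ h
    rw [mem_ball_zero_iff] at h₁ h₂ h₃ h₄
    have hm : ∀ {x : ℂ}, ‖x‖ < δ → c + x ∈ {w | w ≠ 0 ∧ p + w⁻¹ ∈ U} := fun hx =>
      ⟨hV0 _ (hx.trans_le hδr), hVU _ (hx.trans_le hδr)⟩
    have hne : ∀ {x y : ℂ}, x ≠ y → c + x ≠ c + y := fun h => by simpa using h
    have := hφ.inversion hinj hp _ (hm h₁) _ (hm h₂) _ (hm h₃) _ (hm h₄) (hne h₁₂) (hne h₁₃)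
      (hne h₁₄) (hne h₂₃) (hne h₂₄) (hne h₃₄) (by simpa using h)
    simp only [← hlin _ h₁, ← hlin _ h₂, ← hlin _ h₃, ← hlin _ h₄]
    simpa [hF] using this
  have hnot : ¬ (a = 0 ∧ b = 0) := by
    rintro ⟨rfl, rfl⟩
    obtain ⟨s, hs, hsδ⟩ := exists_between hδ
    have ns : ‖(s : ℂ)‖ = s := by simp [abs_of_pos hs]
    have hsr : ‖(s : ℂ)‖ < r := by rw [ns]; linarith
    have h1 := hlin s (by rwa [ns])
    simp only [zero_mul, add_zero, hF] at h1
    have h2 := hinj (hVU s hsr) (by rw [hpc]; exact hq)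
      (sub_left_injective (inv_injective (sub_eq_zero.1 h1)))
    simp at h2
    exact hs.ne' h2
  have hev : ∀ᶠ z in 𝓝 q, z ≠ p ∧ f z ≠ f p ∧
      (f z - f p)⁻¹ = F c + a * ((z - p)⁻¹ - c) + b * conj ((z - p)⁻¹ - c) := by
    have hqp : q - p = t := by rw [hp_def]; ring
    have hqp' : q ≠ p := by rw [← sub_ne_zero, hqp]; exact htc
    have hlim : Tendsto (fun z => (z - p)⁻¹ - c) (𝓝 q) (𝓝 0) := by
      have : ContinuousAt (fun z => (z - p)⁻¹ - c) q :=
        ((continuousAt_id.sub continuousAt_const).inv₀ (sub_ne_zero.2 hqp')).sub continuousAt_const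
      simpa [ContinuousAt, hqp, hc_def] using this
    filter_upwards [eventually_ne_nhds hqp', hlim.eventually (Metric.ball_mem_nhds 0 hδ)]
      with z hz hzδ
    rw [dist_zero_right] at hzδ
    have e := hlin _ hzδ
    have hg' := hg _ (hzδ.trans_le hδr)
    simp only [hF, add_sub_cancel, inv_inv] at e hg' ⊢
    exact ⟨hz, sub_ne_zero.1 hg', by linear_combination e⟩
  rcases mul_eq_zero.1 hab with ha | hb
  · right
    have hb : b ≠ 0 := fun hb => hnot ⟨ha, hb⟩
    refine moebiusAt_of_inv_sub_eventuallyEq (p := p) (A := conj b)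
      (B := conj (F c) - conj b * c) (by simpa using hb) (hev.mono ?_)
    rintro z ⟨hz, hfz, e⟩
    refine ⟨hz, fun h => hfz ((starRingEnd ℂ).injective h), ?_⟩
    have e' := congrArg conj e
    simp only [ha, zero_mul, add_zero, map_add, map_mul, map_inv₀, map_sub, Complex.conj_conj]
      at e' ⊢
    linear_combination e'
  · left
    have ha : a ≠ 0 := fun ha => hnot ⟨ha, hb⟩
    refine moebiusAt_of_inv_sub_eventuallyEq (p := p) (B := F c - a * c) ha (hev.mono ?_)
    rintro z ⟨hz, hfz, e⟩
    refine ⟨hz, hfz, ?_⟩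
    rw [e, hb]
    ring

theorem moebius_of_injective_crossRatioCond
    (α : ℂ) (hα0 : α ≠ 0) (hα1 : α ≠ 1)
    (U : Set ℂ) (hUne : U.Nonempty) (hUopen : IsOpen U) (hUconn : IsConnected U)
    (f : ℂ → ℂ) (hf : ContinuousOn f U) (hinj : Set.InjOn f U)
    (hφ : CrossRatioCond α U f) :
    ∃ a b c d : ℂ, a * d - b * c ≠ 0 ∧
      ((∀ z ∈ U, c * z + d ≠ 0 ∧ f z = (a * z + b) / (c * z + d)) ∨
       (∀ z ∈ U, c * (starRingEnd ℂ z) + d ≠ 0 ∧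
          f z = (a * (starRingEnd ℂ z) + b) / (c * (starRingEnd ℂ z) + d))) := by
  have hloc := fun q hq => hφ.moebiusAt_or hα0 hα1 hUopen hf hinj (q := q) hq
  have hsplit := isPreconnected_iff_subset_of_disjoint.1 hUconn.isPreconnected
    {q | MoebiusAt f q} {q | MoebiusAt (fun z => conj (f z)) q}
    (isOpen_setOf_moebiusAt _) (isOpen_setOf_moebiusAt _) hloc
    (Set.eq_empty_of_forall_notMem fun q hq => hq.2.1.not_conj hq.2.2)
  rcases hsplit with h | h
  · obtain ⟨a, b, c, d, hdet, hM⟩ := exists_moebius_of_forall_moebiusAt hUconn h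
    exact ⟨a, b, c, d, hdet, Or.inl hM⟩
  · obtain ⟨a, b, c, d, hdet, hM⟩ := exists_moebius_of_forall_moebiusAt hUconn h
    refine ⟨conj a, conj b, conj c, conj d, ?_, Or.inr fun z hz => ?_⟩
    · simpa only [map_sub, map_mul] using (map_ne_zero (starRingEnd ℂ)).2 hdet
    · obtain ⟨h1, h2⟩ := hM z hz
      constructor
      · simpa only [map_add, map_mul] using (map_ne_zero (starRingEnd ℂ)).2 h1
      · simpa only [map_div₀, map_add, map_mul, Complex.conj_conj] using congrArg conj h2
end

section
/- Let α ∈ ℂ be non-real (α ∉ ℝ), let U ⊆ ℂ be a nonempty open connected set, and let f : ℂ → ℂ be continuous on U, injective on U, and satisfy the cross-ratio condition φ(α) on U. Then f is the restriction to U of a linear-fractional function: there exist a, b, c, d ∈ ℂ with a·d − b·c ≠ 0 such that for all z ∈ U, c·z + d ≠ 0 and f z = (a·z + b)/(c·z + d). -/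
open Filter Topology Metric

/-- A function on a ball that is additive there and continuous at `0` is the restriction of a
continuous real-linear map. -/
theorem exists_continuousLinearMap_of_additive_on_ball {E F : Type*}
    [NormedAddCommGroup E] [NormedSpace ℝ E] [NormedAddCommGroup F] [NormedSpace ℝ F]
    {G : E → F} {δ : ℝ} (hδ : 0 < δ)
    (hadd : ∀ x ∈ ball (0 : E) δ, ∀ y ∈ ball (0 : E) δ, G (x + y) = G x + G y)
    (hG : ContinuousAt G 0) :
    ∃ L : E →L[ℝ] F, ∀ x ∈ ball (0 : E) δ, G x = L x := by
  simp only [mem_ball_zero_iff] at hadd ⊢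
  have hsmall : ∀ x : E, ∃ n : ℕ, ∀ m ≥ n, ‖((1 / 2 : ℝ) ^ m) • x‖ < δ := by
    intro x
    have h : Tendsto (fun m : ℕ => ((1 / 2 : ℝ) ^ m) • x) atTop (𝓝 ((0 : ℝ) • x)) :=
      (tendsto_pow_atTop_nhds_zero_of_lt_one (by norm_num) (by norm_num)).smul_const x
    rw [zero_smul] at h
    have h' := h.eventually (ball_mem_nhds (0 : E) hδ)
    simpa only [dist_zero_right, eventually_atTop] using h'
  have hhalf : ∀ x : E, ‖x‖ < δ → ∀ k : ℕ, (2 : ℝ) ^ k • G (((1 / 2 : ℝ) ^ k) • x) = G x := by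
    intro x hx k
    induction k with
    | zero => simp
    | succ k ih =>
      have hy : ‖((1 / 2 : ℝ) ^ (k + 1)) • x‖ < δ := by
        rw [norm_smul, norm_pow]
        refine lt_of_le_of_lt (mul_le_of_le_one_left (norm_nonneg x) ?_) hx
        exact pow_le_one₀ (norm_nonneg _) (by norm_num)
      have h := hadd _ hy _ hy
      rw [← add_smul, ← two_smul ℝ (G _), pow_succ, ← mul_add, add_halves, mul_one] at h
      rw [← ih, h, smul_smul, ← pow_succ, pow_succ (1 / 2 : ℝ) k]
  choose N hN using hsmall
  let H : E → F := fun x => (2 : ℝ) ^ (N x) • G (((1 / 2 : ℝ) ^ (N x)) • x)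
  have hH : ∀ x : E, ∀ m ≥ N x, H x = (2 : ℝ) ^ m • G (((1 / 2 : ℝ) ^ m) • x) := by
    intro x m hm
    obtain ⟨k, rfl⟩ := Nat.exists_eq_add_of_le hm
    have h := hhalf _ (hN x _ le_rfl) k
    rw [smul_smul, ← pow_add, add_comm k] at h
    rw [pow_add, mul_smul, h]
  have hHG : ∀ x : E, ‖x‖ < δ → H x = G x := fun x hx => hhalf x hx _
  have hHadd : ∀ x y, H (x + y) = H x + H y := by
    intro x y
    let m := max (N x) (max (N y) (N (x + y)))
    have hx : N x ≤ m := le_max_left _ _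
    have hy : N y ≤ m := (le_max_left _ _).trans (le_max_right _ _)
    have hxy : N (x + y) ≤ m := (le_max_right _ _).trans (le_max_right _ _)
    rw [hH x m hx, hH y m hy, hH _ m hxy, smul_add, hadd _ (hN x m hx) _ (hN y m hy), smul_add]
  have hcont : ContinuousAt H 0 := by
    refine hG.congr ?_
    filter_upwards [ball_mem_nhds (0 : E) hδ] with x hx
    exact (hHG x (mem_ball_zero_iff.mp hx)).symm
  let A : E →+ F := AddMonoidHom.mk' H hHadd
  have hA : Continuous A := continuous_of_continuousAt_zero A hcont
  exact ⟨A.toRealLinearMap hA, fun x hx => (hHG x hx).symm⟩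

/-- A real-linear map of `ℂ` commuting with multiplication by a non-real number is
multiplication by a complex number. -/
theorem eq_mul_of_commutes_nonreal {α : ℂ} (hα : α.im ≠ 0) (L : ℂ →L[ℝ] ℂ)
    (h : ∀ x, L (α * x) = α * L x) (x : ℂ) : L x = L 1 * x := by
  have hI : L Complex.I = Complex.I * L 1 := by
    have h1 := h 1
    have e : α * 1 = α.re • (1 : ℂ) + α.im • Complex.I := by
      simp [Complex.re_add_im]
    rw [e, map_add, map_smul, map_smul] at h1
    simp only [Complex.real_smul] at h1
    have hα' : (α.im : ℂ) ≠ 0 := by exact_mod_cast hα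
    apply mul_left_cancel₀ hα'
    linear_combination h1 - L 1 * Complex.re_add_im α
  have e : x = x.re • (1 : ℂ) + x.im • Complex.I := by
    simp [Complex.re_add_im]
  conv_lhs => rw [e]
  rw [map_add, map_smul, map_smul, hI]
  simp only [Complex.real_smul]
  linear_combination L 1 * Complex.re_add_im x

/-- A continuous function on an open set that preserves affine combinations with a fixed
non-real weight is locally complex-affine. -/
theorem eventually_eq_affine_of_nonreal_combination {α : ℂ} (hα : α.im ≠ 0) {V : Set ℂ}
    (hV : IsOpen V) {F : ℂ → ℂ} (hF : ContinuousOn F V)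
    (hcomb : ∀ a ∈ V, ∀ b ∈ V, (1 - α) * a + α * b ∈ V →
      F ((1 - α) * a + α * b) = (1 - α) * F a + α * F b)
    {w : ℂ} (hw : w ∈ V) : ∃ m : ℂ, ∀ᶠ v in 𝓝 w, F v = F w + m * (v - w) := by
  have hα0 : α ≠ 0 := by rintro rfl; simp at hα
  have hα1 : 1 - α ≠ 0 := by
    intro h
    apply hα
    rw [← sub_eq_zero.mp h, Complex.one_im]
  obtain ⟨r, hr, hrV⟩ := Metric.isOpen_iff.mp hV w hw
  let G : ℂ → ℂ := fun x => F (w + x) - F w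
  have hmem : ∀ x : ℂ, ‖x‖ < r → w + x ∈ V := fun x hx => hrV (by simpa using hx)
  have hG : ∀ a b : ℂ, ‖a‖ < r → ‖b‖ < r → ‖(1 - α) * a + α * b‖ < r →
      G ((1 - α) * a + α * b) = (1 - α) * G a + α * G b := by
    intro a b ha hb hab
    have e : (1 - α) * (w + a) + α * (w + b) = w + ((1 - α) * a + α * b) := by ring
    have h := hcomb _ (hmem a ha) _ (hmem b hb) (by rw [e]; exact hmem _ hab)
    rw [e] at h
    simp only [G, h]
    ring
  have hG0 : G 0 = 0 := by simp [G]
  have hGα : ∀ b : ℂ, ‖b‖ < r → ‖α * b‖ < r → G (α * b) = α * G b := by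
    intro b hb hb'
    simpa [hG0] using hG 0 b (by simpa using hr) hb (by simpa using hb')
  have hGα' : ∀ a : ℂ, ‖a‖ < r → ‖(1 - α) * a‖ < r → G ((1 - α) * a) = (1 - α) * G a := by
    intro a ha ha'
    simpa [hG0] using hG a 0 ha (by simpa using hr) (by simpa using ha')
  have hev : ∀ᶠ x : ℂ in 𝓝 0,
      ‖x‖ < r / 2 ∧ ‖x / α‖ < r ∧ ‖x / (1 - α)‖ < r ∧ ‖α * x‖ < r := by
    have hlt : ∀ (g : ℂ → ℂ) (s : ℝ), 0 < s → Continuous g → g 0 = 0 →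
        ∀ᶠ x in 𝓝 0, ‖g x‖ < s := fun g s hs hg hg0 =>
      hg.norm.continuousAt.eventually_lt continuousAt_const (by simpa [hg0] using hs)
    exact (hlt (fun x => x) _ (half_pos hr) (by fun_prop) rfl).and
      ((hlt (fun x => x / α) r hr (by fun_prop) (by simp)).and
      ((hlt (fun x => x / (1 - α)) r hr (by fun_prop) (by simp)).and
      (hlt (fun x => α * x) r hr (by fun_prop) (by simp))))
  obtain ⟨δ, hδ, hδr⟩ := Metric.eventually_nhds_iff_ball.mp hev
  have hadd : ∀ x ∈ ball (0 : ℂ) δ, ∀ y ∈ ball (0 : ℂ) δ, G (x + y) = G x + G y := by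
    intro x hx y hy
    obtain ⟨hx1, -, hx3, -⟩ := hδr x hx
    obtain ⟨hy1, hy2, -, -⟩ := hδr y hy
    have ex : (1 - α) * (x / (1 - α)) = x := mul_div_cancel₀ x hα1
    have ey : α * (y / α) = y := mul_div_cancel₀ y hα0
    have hxy : ‖x + y‖ < r := (norm_add_le x y).trans_lt (by linarith)
    have h := hG _ _ hx3 hy2 (by rwa [ex, ey])
    have h1 := hGα' _ hx3 (by rw [ex]; linarith)
    have h2 := hGα _ hy2 (by rw [ey]; linarith)
    rw [ex] at h h1
    rw [ey] at h h2
    rw [h, h1, h2]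
  have hGc : ContinuousAt G 0 := by
    have h : ContinuousAt F (w + 0) := by
      rw [add_zero]
      exact hF.continuousAt (hV.mem_nhds hw)
    exact (ContinuousAt.comp (f := fun x : ℂ => w + x) h (by fun_prop)).sub continuousAt_const
  obtain ⟨L, hL⟩ := exists_continuousLinearMap_of_additive_on_ball hδ hadd hGc
  have hLα : ∀ x, L (α * x) = α * L x := by
    let L₁ : ℂ →L[ℝ] ℂ := L.comp (ContinuousLinearMap.mul ℝ ℂ α)
    let L₂ : ℂ →L[ℝ] ℂ := (ContinuousLinearMap.mul ℝ ℂ α).comp L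
    have hloc : ∀ᶠ x : ℂ in 𝓝 0, L₁ x = L₂ x := by
      have hαx : ∀ᶠ x : ℂ in 𝓝 0, α * x ∈ ball (0 : ℂ) δ :=
        (by fun_prop : Continuous fun x : ℂ => α * x).continuousAt.eventually_mem
          (isOpen_ball.mem_nhds (by simpa using hδ))
      filter_upwards [hαx, ball_mem_nhds (0 : ℂ) hδ] with x hx' hx
      obtain ⟨h1, -, -, h4⟩ := hδr x hx
      change L (α * x) = α * L x
      rw [← hL _ hx', ← hL _ hx]
      exact hGα x (by linarith) h4
    have heq : L₁ = L₂ := by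
      have h1 := L₁.hasFDerivAt (x := 0)
      exact (h1.congr_of_eventuallyEq (EventuallyEq.symm hloc)).unique L₂.hasFDerivAt
    intro x
    exact DFunLike.congr_fun heq x
  refine ⟨L 1, ?_⟩
  filter_upwards [ball_mem_nhds w hδ] with v hv
  have hv' : v - w ∈ ball (0 : ℂ) δ := by simpa [dist_eq_norm] using hv
  have h := hL _ hv'
  rw [eq_mul_of_commutes_nonreal hα L hLα] at h
  simp only [G, add_sub_cancel] at h
  rw [← h, add_sub_cancel]

/-- Sending one point to infinity in source and target turns the cross-ratio condition into
preservation of affine combinations. -/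
theorem CrossRatioCond.inv_sub_combination {α : ℂ} (hα0 : α ≠ 0) (hα1 : α ≠ 1) {U : Set ℂ}
    {f : ℂ → ℂ} (hinj : Set.InjOn f U) (hφ : CrossRatioCond α U f) {p : ℂ} (hp : p ∈ U)
    {a b : ℂ} (ha0 : a ≠ 0) (hb0 : b ≠ 0) (hc0 : (1 - α) * a + α * b ≠ 0)
    (ha : p + a⁻¹ ∈ U) (hb : p + b⁻¹ ∈ U) (hc : p + ((1 - α) * a + α * b)⁻¹ ∈ U) :
    (f (p + ((1 - α) * a + α * b)⁻¹) - f p)⁻¹ =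
      (1 - α) * (f (p + a⁻¹) - f p)⁻¹ + α * (f (p + b⁻¹) - f p)⁻¹ := by
  rcases eq_or_ne a b with rfl | hab
  · have e : (1 - α) * a + α * a = a := by ring
    rw [e]
    ring
  have hac : a ≠ (1 - α) * a + α * b := fun h =>
    mul_ne_zero hα0 (sub_ne_zero.mpr hab) (by linear_combination h)
  have hbc : b ≠ (1 - α) * a + α * b := fun h =>
    mul_ne_zero (sub_ne_zero.mpr hα1) (sub_ne_zero.mpr hab) (by linear_combination h)
  have key : -b⁻¹ * (a⁻¹ - ((1 - α) * a + α * b)⁻¹) =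
      α * ((b⁻¹ - a⁻¹) * ((1 - α) * a + α * b)⁻¹) := by
    have e : a - ((1 - α) * a + α * b) = α * (a - b) := by ring
    generalize (1 - α) * a + α * b = c at *
    field_simp
    linear_combination e
  generalize (1 - α) * a + α * b = c at *
  have hpa : p ≠ p + a⁻¹ := by simpa using ha0
  have hpb : p ≠ p + b⁻¹ := by simpa using hb0
  have hpc : p ≠ p + c⁻¹ := by simpa using hc0
  have h := hφ p hp _ ha _ hb _ hc hpa hpb hpc (by simpa using hab) (by simpa using hac)
    (by simpa using hbc) (by linear_combination key)
  have hfa : f (p + a⁻¹) - f p ≠ 0 := sub_ne_zero.mpr fun e => hpa (hinj ha hp e).symm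
  have hfb : f (p + b⁻¹) - f p ≠ 0 := sub_ne_zero.mpr fun e => hpb (hinj hb hp e).symm
  have hfc : f (p + c⁻¹) - f p ≠ 0 := sub_ne_zero.mpr fun e => hpc (hinj hc hp e).symm
  generalize f (p + a⁻¹) = A at *
  generalize f (p + b⁻¹) = B at *
  generalize f (p + c⁻¹) = C at *
  field_simp
  linear_combination -h

/-- A continuous injective function satisfying a non-real cross-ratio condition is
linear-fractional near every point. -/
theorem CrossRatioCond.eventually_linearFractional {α : ℂ} (hα : α.im ≠ 0) {U : Set ℂ}
    (hU : IsOpen U) {f : ℂ → ℂ} (hf : ContinuousOn f U) (hinj : Set.InjOn f U)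
    (hφ : CrossRatioCond α U f) {q : ℂ} (hq : q ∈ U) :
    ∃ a b c d : ℂ, a * d - b * c ≠ 0 ∧
      ∀ᶠ z in 𝓝 q, c * z + d ≠ 0 ∧ f z = (a * z + b) / (c * z + d) := by
  have hα0 : α ≠ 0 := by rintro rfl; simp at hα
  have hα1 : α ≠ 1 := by rintro rfl; simp at hα
  obtain ⟨p, hpq, hp⟩ : ∃ p, p ≠ q ∧ p ∈ U := by
    have h : ∀ᶠ p in 𝓝[≠] q, p ≠ q ∧ p ∈ U :=
      eventually_mem_nhdsWithin.and (mem_nhdsWithin_of_mem_nhds (hU.mem_nhds hq))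
    exact h.exists
  let V : Set ℂ := {0}ᶜ ∩ (fun w : ℂ => p + w⁻¹) ⁻¹' U
  have hinv : ContinuousOn (fun w : ℂ => p + w⁻¹) {0}ᶜ :=
    continuousOn_const.add continuousOn_inv₀
  have hV : IsOpen V := hinv.isOpen_inter_preimage isOpen_compl_singleton hU
  let F : ℂ → ℂ := fun w => (f (p + w⁻¹) - f p)⁻¹
  have hne : ∀ z ∈ U, z ≠ p → f z - f p ≠ 0 := fun z hz hzp =>
    sub_ne_zero.mpr fun e => hzp (hinj hz hp e)
  have hF : ContinuousOn F V := by
    refine ContinuousOn.inv₀ ?_ ?_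
    · exact (hf.comp (hinv.mono Set.inter_subset_left) fun w hw => hw.2).sub continuousOn_const
    · exact fun w hw => hne _ hw.2 (by simpa using hw.1)
  have hqp : q - p ≠ 0 := sub_ne_zero.mpr hpq.symm
  have hw : (q - p)⁻¹ ∈ V := ⟨by simpa using hqp, by simpa using hq⟩
  obtain ⟨m, hm⟩ := eventually_eq_affine_of_nonreal_combination hα hV hF
    (fun a ha b hb hc => hφ.inv_sub_combination hα0 hα1 hinj hp ha.1 hb.1 hc.1 ha.2 hb.2 hc.2) hw
  have hcont : ContinuousAt (fun z : ℂ => (z - p)⁻¹) q := by fun_prop (disch := exact hqp)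
  set k : ℂ := F (q - p)⁻¹ - m * (q - p)⁻¹ with hk
  have hloc : ∀ᶠ z in 𝓝 q, z ≠ p ∧ z ∈ U ∧ (f z - f p)⁻¹ = k + m * (z - p)⁻¹ := by
    filter_upwards [hcont.eventually hm, hU.mem_nhds hq, isOpen_ne.mem_nhds hpq.symm]
      with z hz hzU hzp
    refine ⟨hzp, hzU, ?_⟩
    simp only [F, inv_inv, add_sub_cancel] at hz hk
    rw [hz, hk]
    ring
  have hm0 : m ≠ 0 := by
    rintro rfl
    have h : ∀ᶠ z in 𝓝[≠] q, z ≠ q ∧ z ∈ U ∧ f z = f q := by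
      have hq' := hloc.self_of_nhds.2.2
      filter_upwards [eventually_mem_nhdsWithin, hloc.filter_mono nhdsWithin_le_nhds]
        with z hz ⟨_, hzU, hz'⟩
      refine ⟨hz, hzU, ?_⟩
      simp only [zero_mul] at hz' hq'
      exact sub_left_injective (inv_injective (hz'.trans hq'.symm))
    obtain ⟨z, hz, hzU, hfz⟩ := h.exists
    exact hz (hinj hzU hq hfz)
  refine ⟨f p * k + 1, f p * (m - k * p) - p, k, m - k * p, ?_, ?_⟩
  · have e : (f p * k + 1) * (m - k * p) - (f p * (m - k * p) - p) * k = m := by ring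
    rwa [e]
  · filter_upwards [hloc] with z ⟨hzp, hzU, hz⟩
    have hzp' : z - p ≠ 0 := sub_ne_zero.mpr hzp
    have hfz := hne z hzU hzp
    have e : (f z - f p) * (k * z + (m - k * p)) = z - p := by
      field_simp at hz
      linear_combination -hz
    have hden : k * z + (m - k * p) ≠ 0 := fun h => hzp' (by rw [← e, h, mul_zero])
    refine ⟨hden, ?_⟩
    rw [eq_div_iff hden]
    linear_combination e

theorem linearFractional_of_injective_crossRatioCond_nonreal
    (α : ℂ) (hα : α ∉ Set.range ((↑) : ℝ → ℂ))
    (U : Set ℂ) (hUne : U.Nonempty) (hUopen : IsOpen U) (hUconn : IsConnected U)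
    (f : ℂ → ℂ) (hf : ContinuousOn f U) (hinj : Set.InjOn f U)
    (hφ : CrossRatioCond α U f) :
    ∃ a b c d : ℂ, a * d - b * c ≠ 0 ∧
      ∀ z ∈ U, c * z + d ≠ 0 ∧ f z = (a * z + b) / (c * z + d) := by
  have him : α.im ≠ 0 := fun h => hα ⟨α.re, Complex.ext (by simp) (by simp [h])⟩
  have hloc : ∀ q ∈ U, _ := fun q hq => hφ.eventually_linearFractional him hUopen hf hinj hq
  have han : AnalyticOnNhd ℂ f U := by
    intro q hq
    obtain ⟨a, b, c, d, -, h⟩ := hloc q hq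
    have h' : AnalyticAt ℂ (fun z => (a * z + b) / (c * z + d)) q :=
      AnalyticAt.div (by fun_prop) (by fun_prop) h.self_of_nhds.1
    exact h'.congr (h.mono fun z hz => hz.2.symm)
  obtain ⟨q, hq⟩ := hUne
  obtain ⟨a, b, c, d, hdet, h⟩ := hloc q hq
  have heq : Set.EqOn (fun z => f z * (c * z + d)) (fun z => a * z + b) U := by
    refine AnalyticOnNhd.eqOn_of_preconnected_of_eventuallyEq
      (han.mul fun z _ => by fun_prop) (fun z _ => by fun_prop) hUconn.isPreconnected hq ?_
    filter_upwards [h] with z hz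
    exact (eq_div_iff hz.1).mp hz.2
  refine ⟨a, b, c, d, hdet, fun z hz => ?_⟩
  have e : f z * (c * z + d) = a * z + b := heq hz
  have hden : c * z + d ≠ 0 := by
    intro h0
    rw [h0, mul_zero] at e
    exact hdet (by linear_combination a * h0 + c * e)
  exact ⟨hden, (eq_div_iff hden).mpr e⟩
end
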